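/- arXiv:1112.0156 — 2 statements merged into one kernel-verified Lean document; each statement's English description precedes it below -/
import Mathlib

section
/- For every integer r ≥ 1, C_r(q) = Σ_{m=0}^{⌊(r-1)/2⌋} q^m · (q+1)^{r-2m-1} · binom(r-1,2m) · Cat_m, as an identity of polynomials in q, where Cat_m is the m-th Catalan number. -/
open Polynomial Finset

/-- The Narayana polynomial `C_n(q)`. -/
noncomputable def narayana (n : ℕ) : Polynomial ℚ :=
  if n = 0 then 1
  else ∑ k ∈ Finset.Icc 1 n,
    Polynomial.C ((n.choose (k - 1) * n.choose k : ℚ) / n) * Polynomial.X ^ (k - 1)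

/-- The coefficients of the Narayana polynomial `C_{n+1}(q)`. -/
theorem coeff_narayana_succ (n j : ℕ) :
    (narayana (n + 1)).coeff j =
      ((n + 1).choose j * (n + 1).choose (j + 1) : ℚ) / ((n + 1 : ℕ) : ℚ) := by
  rw [narayana, if_neg n.succ_ne_zero, ← Finset.Ico_add_one_right_eq_Icc,
    Finset.sum_Ico_eq_sum_range, finsetSum_coeff]
  simp only [coeff_C_mul, coeff_X_pow, mul_ite, mul_one, mul_zero, Nat.add_sub_cancel,
    Nat.add_sub_cancel_left, Finset.sum_ite_eq, Finset.mem_range]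
  split_ifs with h
  · rw [add_comm 1 j]
  · rw [Nat.choose_eq_zero_of_lt (show n + 1 < j + 1 by omega)]
    simp

/-- A form of Vandermonde's identity. -/
theorem sum_choose_mul_choose_succ (j k : ℕ) :
    ∑ m ∈ Finset.range (j + 1), j.choose m * k.choose (m + 1) = (j + k).choose (j + 1) := by
  rw [Nat.add_choose_eq, Finset.Nat.sum_antidiagonal_succ', Nat.choose_succ_self, zero_mul,
    zero_add, ← Finset.Nat.sum_antidiagonal_swap, Finset.Nat.sum_antidiagonal_eq_sum_range_succ_mk]
  refine Finset.sum_congr rfl fun m hm => ?_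
  simp [Nat.choose_symm (Nat.lt_succ_iff.mp (Finset.mem_range.mp hm))]

theorem cast_catalan_eq_factorial_div (m : ℕ) :
    (catalan m : ℚ) = (2 * m).factorial / (m.factorial * (m + 1).factorial) := by
  have h := succ_mul_catalan_eq_centralBinom m
  have h2 := Nat.add_choose_mul_factorial_mul_factorial m m
  rw [← two_mul, ← Nat.centralBinom_eq_two_mul_choose, ← h] at h2
  rw [eq_div_iff (by positivity), ← h2, Nat.factorial_succ]
  push_cast
  ring

theorem succ_mul_choose_mul_catalan_mul_choose (a b m : ℕ) :
    ((a + b + 2 * m + 1 : ℕ) : ℚ) *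
        (((a + b + 2 * m).choose (2 * m) * catalan m) * (a + b).choose a) =
      (a + m + (b + (m + 1))).choose (a + m) *
        ((a + m).choose m * (b + (m + 1)).choose (m + 1)) := by
  rw [add_comm (a + b) (2 * m), add_comm a m, add_comm b (m + 1), Nat.cast_add_choose,
    Nat.cast_add_choose, Nat.cast_add_choose, Nat.cast_add_choose, Nat.cast_add_choose,
    cast_catalan_eq_factorial_div, show m + a + (m + 1 + b) = 2 * m + (a + b) + 1 by ring,
    Nat.factorial_succ (2 * m + (a + b))]
  push_cast
  field_simp

theorem narayana_touchard_expansion (r : ℕ) (hr : 1 ≤ r) :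
    narayana r =
      ∑ m ∈ Finset.range ((r - 1) / 2 + 1),
        Polynomial.X ^ m * (Polynomial.X + 1) ^ (r - 2 * m - 1) *
          Polynomial.C (((r - 1).choose (2 * m) * catalan m : ℚ)) := by
  obtain ⟨n, rfl⟩ : ∃ n, r = n + 1 := ⟨r - 1, by omega⟩
  ext j
  rw [coeff_narayana_succ, div_eq_iff (by positivity), finsetSum_coeff, Finset.sum_mul]
  rcases lt_or_ge (n + 1) j with hj | hj
  · rw [Nat.choose_eq_zero_of_lt hj, Nat.cast_zero, zero_mul]
    refine (Finset.sum_eq_zero fun m hm => ?_).symm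
    rw [coeff_mul_C, coeff_X_pow_mul', coeff_X_add_one_pow,
      Nat.choose_eq_zero_of_lt (by have := Finset.mem_range.mp hm; omega)]
    simp
  obtain ⟨k, hk⟩ := Nat.exists_eq_add_of_le hj
  rw [hk, ← sum_choose_mul_choose_succ, Nat.cast_sum, Finset.mul_sum, ← hk]
  have term : ∀ m, (X ^ m * (X + 1) ^ (n + 1 - 2 * m - 1) *
      C (((n + 1 - 1).choose (2 * m) * catalan m : ℚ))).coeff j * ((n + 1 : ℕ) : ℚ) =
      ((n + 1).choose j : ℚ) * ((j.choose m * k.choose (m + 1) : ℕ) : ℚ) := by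
    intro m
    rw [coeff_mul_C, coeff_X_pow_mul', coeff_X_add_one_pow]
    split_ifs with hm
    · rcases lt_or_ge m k with hmk | hmk
      · obtain ⟨a, rfl⟩ := Nat.exists_eq_add_of_le' hm
        obtain ⟨b, rfl⟩ := Nat.exists_eq_add_of_le' (Nat.succ_le_of_lt hmk)
        have hn : n = a + b + 2 * m := by omega
        have h := succ_mul_choose_mul_catalan_mul_choose a b m
        rw [Nat.add_sub_cancel, Nat.add_sub_cancel,
          show n + 1 - 2 * m - 1 = a + b by omega]
        rw [← hn, ← hk] at h
        push_cast at h ⊢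
        linarith
      · rw [Nat.choose_eq_zero_of_lt (show k < m + 1 by omega)]
        rcases lt_or_ge n (2 * m) with h | h
        · rw [Nat.add_sub_cancel, Nat.choose_eq_zero_of_lt h]
          simp
        · rw [Nat.choose_eq_zero_of_lt (show n + 1 - 2 * m - 1 < j - m by omega)]
          simp
    · rw [Nat.choose_eq_zero_of_lt (show j < m by omega)]
      simp
  refine (Finset.sum_congr_of_eq_on_inter ?_ ?_ fun m _ _ => term m).symm
  · intro m hm hmj
    rw [term, Nat.choose_eq_zero_of_lt (show j < m by simpa using hmj)]
    simp
  · intro m hm hmn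
    rw [Finset.mem_range] at hm hmn
    rw [Nat.choose_eq_zero_of_lt (show k < m + 1 by omega)]
    simp
end

section
/- For every integer n ≥ 1, the Narayana polynomials satisfy the recurrence C_n(q) = (1-q)^{n-1} + q·Σ_{k=1}^{n-1} C_{n-k}(q) · Σ_{m=0}^{k-1} (-1)^m · binom(k-1,m) · binom(n-m,k) · (1-q)^{k-m-1}, as an identity of polynomials in q. (This generalizes Koshy's formula for Catalan numbers, recovered at q = 1.) -/
open Polynomial Finset

theorem coeff_narayana {n : ℕ} (hn : n ≠ 0) (i : ℕ) :
    (narayana n).coeff i = (n.choose i * n.choose (i + 1) : ℚ) / n := by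
  have h : ∀ k ∈ Icc 1 n, (C ((n.choose (k - 1) * n.choose k : ℚ) / n) *
      X ^ (k - 1)).coeff i =
        if k = i + 1 then (n.choose i * n.choose (i + 1) : ℚ) / n else 0 := by
    intro k hk
    obtain ⟨k, rfl⟩ := Nat.exists_eq_add_of_le' (mem_Icc.mp hk).1
    rw [coeff_C_mul_X_pow]
    by_cases h : i = k
    · simp [h]
    · simp [h, Ne.symm h]
  rw [narayana, if_neg hn, finsetSum_coeff, sum_congr rfl h,
    sum_ite_eq']
  split_ifs with hi
  · rfl
  · rw [Nat.choose_eq_zero_of_lt (k := i + 1) (by simpa using hi)]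
    simp

theorem narayana_three_term (n : ℕ) :
    ((n : ℚ[X]) + 3) * narayana (n + 2) =
      (2 * (n : ℚ[X]) + 3) * (1 + X) * narayana (n + 1) -
        (n : ℚ[X]) * (1 - X) ^ 2 * narayana n := by
  have hstep (k : ℕ) : (n.choose (k + 1) : ℚ) = n.choose k * (n - k) / (k + 1) := by
    rw [eq_div_iff (by positivity)]
    rcases le_or_gt k n with h | h
    · have := Nat.choose_succ_right_eq n k
      rw [← Nat.cast_sub h]
      exact_mod_cast this
    · rw [Nat.choose_eq_zero_of_lt h, Nat.choose_eq_zero_of_lt (by omega)]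
      simp
  have hn0 (i : ℕ) : (n : ℚ) * (narayana n).coeff i = n.choose i * n.choose (i + 1) := by
    rcases eq_or_ne n 0 with rfl | hn
    · simp
    · rw [coeff_narayana hn, mul_div_cancel₀ _ (by exact_mod_cast hn)]
  have e : ((n : ℚ[X]) + 3) * narayana (n + 2) -
      (2 * (n : ℚ[X]) + 3) * (1 + X) * narayana (n + 1) +
        (n : ℚ[X]) * (1 - X) ^ 2 * narayana n =
      C ((n : ℚ) + 3) * narayana (n + 2) -
      C (2 * (n : ℚ) + 3) * (narayana (n + 1) + X * narayana (n + 1)) +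
        (C (n : ℚ) * narayana n - 2 * (X * (C (n : ℚ) * narayana n))
          + X * (X * (C (n : ℚ) * narayana n))) := by
    simp only [map_add, map_mul, map_natCast, map_ofNat]
    ring
  rw [← sub_eq_zero, ← sub_add, e]
  ext i
  have h1 : (n : ℚ) + 1 ≠ 0 := by positivity
  have h2 : (n : ℚ) + 2 ≠ 0 := by positivity
  have c1 : (n.choose 1 : ℚ) = n := by simp
  have c2 : (n.choose 2 : ℚ) = n * (n - 1) / 2 := by
    rw [hstep 1, c1]
    norm_num
  have two (p : ℚ[X]) (i : ℕ) : (2 * p).coeff i = 2 * p.coeff i := by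
    rw [← coeff_C_mul, map_ofNat]
  rcases i with _ | _ | j
  · simp [coeff_narayana, hn0, two, mul_coeff_zero]
    field_simp
    ring
  · simp only [coeff_add, coeff_sub, two, coeff_C_mul,
      coeff_X_mul, hn0, coeff_X_mul_zero, coeff_zero,
      coeff_narayana n.succ_ne_zero, coeff_narayana (n + 1).succ_ne_zero, Nat.choose_succ_succ,
      Nat.choose_zero_right, zero_add, Nat.reduceAdd]
    push_cast
    simp only [c1, c2]
    field_simp
    ring
  · simp only [coeff_add, coeff_sub, two, coeff_C_mul,
      coeff_X_mul, hn0, coeff_zero,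
      coeff_narayana n.succ_ne_zero, coeff_narayana (n + 1).succ_ne_zero, Nat.choose_succ_succ,
      hstep]
    push_cast
    simp only [hstep]
    push_cast
    field_simp
    ring

theorem coeff_one_sub_X_pow_powerSeries (i s : ℕ) :
    PowerSeries.coeff s ((1 - PowerSeries.X : PowerSeries ℚ[X]) ^ i) =
      (-1) ^ s * (i.choose s : ℚ[X]) := by
  have h : (1 - PowerSeries.X : PowerSeries ℚ[X]) ^ i =
      PowerSeries.rescale (-1) (((1 + X) ^ i : ℚ[X][X]) : PowerSeries ℚ[X]) := by
    simp [sub_eq_add_neg]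
  rw [h, PowerSeries.coeff_rescale, coeff_coe, coeff_one_add_X_pow]

theorem choose_mul_choose_add_comm (i s r : ℕ) :
    i.choose s * (i + r).choose i = (s + r).choose s * (i + r).choose (s + r) := by
  rcases lt_or_ge i s with h | h
  · rw [Nat.choose_eq_zero_of_lt h, Nat.choose_eq_zero_of_lt (show i + r < s + r by omega)]
    simp
  · rw [mul_comm, mul_comm ((s + r).choose s), Nat.choose_mul h, Nat.choose_mul (by omega)]
    congr 1
    rw [Nat.add_sub_cancel_left, ← Nat.choose_symm (by omega)]
    congr 1
    omega

/-- The inner sum of the recurrence, with `j = n - k` and `l = k - 1`. -/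
noncomputable def koshyCoeff (j l : ℕ) : ℚ[X] :=
  ∑ m ∈ range (l + 1), (-1) ^ m * C ((l.choose m * (j + (l + 1) - m).choose (l + 1) : ℚ)) *
    (1 - X) ^ (l + 1 - m - 1)

theorem mk_pow_mul_choose_mul_pow_eq_one (y : ℚ[X]) (i : ℕ) :
    (PowerSeries.mk fun l => y ^ l * ((i + l).choose i : ℚ[X])) *
      (1 - PowerSeries.C y * PowerSeries.X) ^ (i + 1) = 1 := by
  have h := congrArg (PowerSeries.rescale y)
    (PowerSeries.mk_add_choose_mul_one_sub_pow_eq_one ℚ[X] i)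
  simpa [PowerSeries.rescale_mk, PowerSeries.rescale_X] using h

theorem coeff_one_sub_X_pow_mul (y : ℚ[X]) (i l : ℕ) :
    PowerSeries.coeff l ((1 - PowerSeries.X : PowerSeries ℚ[X]) ^ i *
        PowerSeries.mk fun l => y ^ l * ((i + l).choose i : ℚ[X])) =
      ∑ m ∈ range (l + 1), (-1) ^ m * ((l.choose m * (i + (l - m)).choose l : ℕ) : ℚ[X]) *
        y ^ (l - m) := by
  rw [PowerSeries.coeff_mul, Nat.sum_antidiagonal_eq_sum_range_succ_mk]
  refine sum_congr rfl fun m hm => ?_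
  have hm : m ≤ l := by simpa [Nat.lt_succ_iff] using hm
  have h := choose_mul_choose_add_comm i m (l - m)
  rw [Nat.add_sub_cancel' hm] at h
  rw [← h, coeff_one_sub_X_pow_powerSeries, PowerSeries.coeff_mk]
  push_cast
  ring

theorem koshyCoeff_zero (l : ℕ) : koshyCoeff 0 l = (1 - X) ^ l := by
  rw [koshyCoeff, sum_eq_single 0]
  · simp
  · intro m _ hm
    rw [Nat.choose_eq_zero_of_lt (show 0 + (l + 1) - m < l + 1 by omega)]
    simp
  · simp

theorem koshyCoeff_succ (j l : ℕ) :
    koshyCoeff (j + 1) l = koshyCoeff j l +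
      ∑ m ∈ range (l + 1), (-1) ^ m * ((l.choose m * (j + 1 + (l - m)).choose l : ℕ) : ℚ[X]) *
        (1 - X) ^ (l - m) := by
  rw [koshyCoeff, koshyCoeff, ← sum_add_distrib]
  refine sum_congr rfl fun m hm => ?_
  have hm : m ≤ l := by simpa [Nat.lt_succ_iff] using hm
  rw [show j + 1 + (l + 1) - m = (j + 1 + (l - m)) + 1 by omega,
    show j + (l + 1) - m = j + 1 + (l - m) by omega, show l + 1 - m - 1 = l - m by omega,
    Nat.choose_succ_succ]
  simp only [map_mul, map_natCast]
  push_cast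
  ring

/-- The generating function of `koshyCoeff j` in terms of `(1 - x) / (1 - (1 - q) x)`. -/
theorem one_sub_X_mul_mk_koshyCoeff {U : PowerSeries ℚ[X]}
    (hU : U * (1 - PowerSeries.C (1 - X) * PowerSeries.X) = 1) (j : ℕ) :
    PowerSeries.C X * PowerSeries.X * PowerSeries.mk (koshyCoeff j) =
      1 - ((1 - PowerSeries.X) * U) ^ (j + 1) := by
  have hP (i : ℕ) : (PowerSeries.mk fun l => (1 - X) ^ l * ((i + l).choose i : ℚ[X])) =
      U ^ (i + 1) := by
    have h := mk_pow_mul_choose_mul_pow_eq_one (1 - X) i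
    refine left_inv_eq_right_inv h ?_
    rw [← mul_pow, mul_comm, hU, one_pow]
  have hq : (PowerSeries.C X * PowerSeries.X) * U = 1 - (1 - PowerSeries.X) * U := by
    rw [map_sub, map_one] at hU
    linear_combination hU
  induction j with
  | zero =>
    have h : PowerSeries.mk (koshyCoeff 0) = U := by
      rw [← pow_one U, ← zero_add 1, ← hP 0]
      ext1 l
      simp [koshyCoeff_zero]
    rw [h, zero_add, pow_one, hq]
  | succ j ih =>
    have h : PowerSeries.mk (koshyCoeff (j + 1)) =
        PowerSeries.mk (koshyCoeff j) + (1 - PowerSeries.X) ^ (j + 1) * U ^ (j + 1 + 1) := by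
      ext1 l
      rw [map_add, PowerSeries.coeff_mk, PowerSeries.coeff_mk, koshyCoeff_succ, ← hP,
        coeff_one_sub_X_pow_mul]
    rw [h, mul_add, ih, mul_pow, mul_pow]
    linear_combination (1 - PowerSeries.X) ^ (j + 1) * U ^ (j + 1) * hq

/-- The generating function of the Narayana polynomials of positive index. -/
noncomputable def narayanaSeries : PowerSeries ℚ[X] :=
  PowerSeries.X * PowerSeries.mk fun n => narayana (n + 1)

theorem narayanaSeries_quadratic :
    narayanaSeries =
      PowerSeries.X * (1 + narayanaSeries) * (1 + PowerSeries.C X * narayanaSeries) := by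
  set F := narayanaSeries with hF
  set x : PowerSeries ℚ[X] := PowerSeries.X with hx
  set S : PowerSeries ℚ[X] := 1 - PowerSeries.C (1 + X) * x - PowerSeries.C (2 * X) * (x * F) with hS
  set D : PowerSeries ℚ[X] :=
    1 - PowerSeries.C (2 * (1 + X)) * x + PowerSeries.C ((1 - X) ^ 2) * (x * x) with hD
  have hS' : S = PowerSeries.mk fun n => match n with
      | 0 => 1
      | 1 => -(1 + X)
      | n + 2 => - (2 * X * narayana (n + 1)) := by
    ext1 n
    rcases n with _ | _ | n
    · simp [hS, hx]
    · simp [hS, hx, hF, narayanaSeries, PowerSeries.coeff_one, mul_assoc,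
        PowerSeries.coeff_succ_X_mul]
    · simp [hS, hx, hF, narayanaSeries, PowerSeries.coeff_one, mul_assoc,
        PowerSeries.coeff_succ_X_mul]
  have hdD : PowerSeries.derivative ℚ[X] D =
      PowerSeries.C (2 * (1 - X) ^ 2) * x - PowerSeries.C (2 * (1 + X)) := by
    simp [hD, hx]
    simp only [map_ofNat]
    ring
  have hone : narayana 1 = 1 := by simp [narayana]
  have hode : 2 * (PowerSeries.derivative ℚ[X] S * D) = PowerSeries.derivative ℚ[X] D * S := by
    rw [hdD, hD]
    have e (T : PowerSeries ℚ[X]) : 2 * (T * (1 - PowerSeries.C (2 * (1 + X)) * x +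
        PowerSeries.C ((1 - X) ^ 2) * (x * x))) = PowerSeries.C 2 * T -
        PowerSeries.C (4 * (1 + X)) * (x * T) + PowerSeries.C (2 * (1 - X) ^ 2) * (x * (x * T)) := by
      simp only [map_mul, map_ofNat]
      ring
    rw [e, sub_mul, mul_assoc, hS', hx]
    ext1 n
    rcases n with _ | _ | _ | n
    all_goals
      simp only [map_add (PowerSeries.coeff _), map_sub (PowerSeries.coeff _),
        PowerSeries.coeff_C_mul, PowerSeries.coeff_succ_X_mul, PowerSeries.coeff_zero_X_mul,
        PowerSeries.coeff_derivative, PowerSeries.coeff_mk]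
      push_cast
    · ring
    · rw [hone]
      ring
    · have h := narayana_three_term 0
      push_cast at h
      linear_combination (-4 * X) * h
    · have h := narayana_three_term (n + 1)
      push_cast at h
      linear_combination (-4 * X) * h
  have hsq : S ^ 2 = D := by
    have hDu : IsUnit D := PowerSeries.isUnit_iff_constantCoeff.mpr (by simp [hD, hx])
    obtain ⟨u, hu⟩ := hDu
    have h : S ^ 2 * (u⁻¹ : (PowerSeries ℚ[X])ˣ) = 1 := by
      refine PowerSeries.derivative.ext ?_ ?_
      · have hu1 : D * (u⁻¹ : (PowerSeries ℚ[X])ˣ) = 1 := by simp [← hu]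
        simp only [Derivation.leibniz, PowerSeries.derivative_inv, hu, smul_eq_mul, pow_two,
          Derivation.map_one_eq_zero]
        linear_combination (S * (u⁻¹ : (PowerSeries ℚ[X])ˣ) ^ 2) * hode -
          2 * S * PowerSeries.derivative ℚ[X] S * (u⁻¹ : (PowerSeries ℚ[X])ˣ) * hu1
      · have h1 : PowerSeries.constantCoeff D = 1 := by simp [hD, hx]
        have h2 : PowerSeries.constantCoeff S = 1 := by simp [hS, hx]
        have h3 := congrArg PowerSeries.constantCoeff u.mul_inv
        rw [map_mul, hu, h1, one_mul] at h3
        simp [h2, h3]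
    rw [← hu]
    exact (Units.mul_inv_eq_one).mp h
  have hprod : PowerSeries.C (4 * X) * x *
      (F - x * (1 + F) * (1 + PowerSeries.C X * F)) = 0 := by
    rw [hS, hD] at hsq
    simp only [map_mul, map_add, map_sub, map_one, map_pow, map_ofNat] at hsq ⊢
    linear_combination -hsq
  have hne : PowerSeries.C (4 * X : ℚ[X]) * x ≠ 0 := by
    refine mul_ne_zero ?_ PowerSeries.X_ne_zero
    intro h
    have := PowerSeries.C_injective (h.trans (map_zero _).symm)
    simp at this
  exact sub_eq_zero.mp ((mul_eq_zero.mp hprod).resolve_left hne)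

theorem X_pow_dvd_trunc_narayanaSeries (n : ℕ) :
    (X : ℚ[X][X]) ^ n ∣ PowerSeries.trunc n narayanaSeries -
      X * (1 + PowerSeries.trunc n narayanaSeries) *
        (1 + C X * PowerSeries.trunc n narayanaSeries) := by
  set P := PowerSeries.trunc n narayanaSeries with hP
  have hx' : PowerSeries.X ^ n ∣ narayanaSeries - (P : PowerSeries ℚ[X]) := by
    rw [PowerSeries.X_pow_dvd_iff]
    intro m hm
    simp [hP, PowerSeries.coeff_trunc, hm]
  have h : PowerSeries.X ^ n ∣
      ((P - X * (1 + P) * (1 + C X * P) : ℚ[X][X]) : PowerSeries ℚ[X]) := by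
    obtain ⟨w, hw⟩ := hx'
    have hq := narayanaSeries_quadratic
    rw [sub_eq_iff_eq_add.mp hw] at hq
    push_cast
    refine ⟨-w + PowerSeries.X * w * (1 + PowerSeries.C X * (P : PowerSeries ℚ[X]))
      + PowerSeries.X * (1 + (P : PowerSeries ℚ[X])) * PowerSeries.C X * w
      + PowerSeries.X * PowerSeries.C X * w * w * PowerSeries.X ^ n, ?_⟩
    linear_combination hq
  rw [PowerSeries.X_pow_dvd_iff] at h
  rw [Polynomial.X_pow_dvd_iff]
  intro d hd
  rw [← coeff_coe, h d hd]

/-- Uniqueness, modulo `x ^ n`, of the solution `x / (1 - x)` of the Narayana functional equation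
at `x (1 - x) / (1 - (1 - q) x)`. -/
theorem X_pow_dvd_of_quadratic {n : ℕ} {U G : PowerSeries ℚ[X]}
    (hU : U * (1 - PowerSeries.C (1 - X) * PowerSeries.X) = 1)
    (hG : PowerSeries.X ^ n ∣ G - PowerSeries.X * ((1 - PowerSeries.X) * U) * (1 + G) *
      (1 + PowerSeries.C X * G)) :
    PowerSeries.X ^ n ∣ (1 - PowerSeries.X) * G - PowerSeries.X := by
  have hunit : IsUnit (1 - PowerSeries.X - PowerSeries.X * (1 - PowerSeries.X) -
      PowerSeries.C X * (PowerSeries.X * ((1 - PowerSeries.X) * U)) *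
        (1 + ((1 - PowerSeries.X) * G - PowerSeries.X))) :=
    PowerSeries.isUnit_iff_constantCoeff.mpr (by simp)
  rw [← hunit.dvd_mul_right]
  refine (hG.mul_left ((1 - PowerSeries.X) ^ 2)).trans (dvd_of_eq ?_)
  rw [map_sub, map_one] at hU
  linear_combination (-PowerSeries.X * (1 - PowerSeries.X)) * ((1 - PowerSeries.X) * (1 + G)) * hU

theorem X_pow_dvd_aeval_trunc_narayanaSeries (n : ℕ) {U : PowerSeries ℚ[X]}
    (hU : U * (1 - PowerSeries.C (1 - X) * PowerSeries.X) = 1) :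
    PowerSeries.X ^ n ∣
      (1 - PowerSeries.X) * (PowerSeries.trunc n narayanaSeries).eval₂ PowerSeries.C
        (PowerSeries.X * ((1 - PowerSeries.X) * U)) - PowerSeries.X := by
  refine X_pow_dvd_of_quadratic hU ?_
  have h := map_dvd (eval₂RingHom PowerSeries.C (PowerSeries.X * ((1 - PowerSeries.X) * U)))
    (X_pow_dvd_trunc_narayanaSeries n)
  simp only [map_sub, map_mul, map_add, map_pow, map_one, coe_eval₂RingHom, eval₂_X, eval₂_C] at h
  exact (pow_dvd_pow_of_dvd (dvd_mul_right _ _) n).trans h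

theorem eval₂_trunc_narayanaSeries (n : ℕ) (z : PowerSeries ℚ[X]) :
    (PowerSeries.trunc (n + 1) narayanaSeries).eval₂ PowerSeries.C z =
      ∑ i ∈ range n, PowerSeries.C (narayana (i + 1)) * z ^ (i + 1) := by
  rw [PowerSeries.eval₂_trunc_eq_sum_range, sum_range_succ']
  simp [narayanaSeries, PowerSeries.coeff_succ_X_mul]

theorem narayana_succ_eq (n : ℕ) :
    narayana (n + 1) = (1 - X) ^ n +
      X * ∑ i ∈ range n, narayana (i + 1) * koshyCoeff (i + 1) (n - 1 - i) := by
  obtain ⟨U, hUcoeff, hU⟩ : ∃ U : PowerSeries ℚ[X],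
      (∀ l, PowerSeries.coeff l U = (1 - X) ^ l) ∧
        U * (1 - PowerSeries.C (1 - X) * PowerSeries.X) = 1 := by
    have h := mk_pow_mul_choose_mul_pow_eq_one (1 - X) 0
    rw [zero_add, pow_one] at h
    exact ⟨_, fun l => by simp, h⟩
  obtain ⟨w, hw⟩ := X_pow_dvd_aeval_trunc_narayanaSeries (n + 2) hU
  rw [eval₂_trunc_narayanaSeries, sub_eq_iff_eq_add] at hw
  have hsum : (∑ i ∈ range (n + 1), PowerSeries.C (narayana (i + 1)) * (PowerSeries.X ^ (i + 1) *
      (PowerSeries.C X * PowerSeries.X * PowerSeries.mk (koshyCoeff (i + 1))))) =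
      (∑ i ∈ range (n + 1), PowerSeries.C (narayana (i + 1)) * PowerSeries.X ^ (i + 1)) -
        PowerSeries.X * U - PowerSeries.X ^ (n + 2) * (w * U) := by
    simp only [one_sub_X_mul_mk_koshyCoeff hU]
    have : PowerSeries.X * U + PowerSeries.X ^ (n + 2) * (w * U) =
        ∑ i ∈ range (n + 1), PowerSeries.C (narayana (i + 1)) * (PowerSeries.X ^ (i + 1) *
          ((1 - PowerSeries.X) * U) ^ (i + 1 + 1)) := by
      trans ((1 - PowerSeries.X) * ∑ i ∈ range (n + 1), PowerSeries.C (narayana (i + 1)) *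
        (PowerSeries.X * ((1 - PowerSeries.X) * U)) ^ (i + 1)) * U
      · rw [hw]
        ring
      · rw [mul_right_comm, mul_sum]
        refine sum_congr rfl fun i _ => ?_
        rw [mul_pow PowerSeries.X, pow_succ _ (i + 1)]
        ring
    rw [sub_sub, this, ← sum_sub_distrib]
    refine sum_congr rfl fun i _ => ?_
    ring
  have hcoeff := congrArg (PowerSeries.coeff (n + 1)) hsum
  have h1 : PowerSeries.coeff (n + 1) (PowerSeries.X ^ (n + 2) * (w * U)) = 0 := by
    rw [PowerSeries.coeff_X_pow_mul', if_neg (by omega)]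
  have h2 : PowerSeries.coeff (n + 1) (∑ i ∈ range (n + 1),
      PowerSeries.C (narayana (i + 1)) * PowerSeries.X ^ (i + 1)) = narayana (n + 1) := by
    rw [map_sum, sum_eq_single_of_mem n (by simp)]
    · rw [PowerSeries.coeff_C_mul, PowerSeries.coeff_X_pow_self, mul_one]
    · intro i _ hi
      rw [PowerSeries.coeff_C_mul, PowerSeries.coeff_X_pow, if_neg (by omega), mul_zero]
  have h3 : PowerSeries.coeff (n + 1) (PowerSeries.X * U) = (1 - X) ^ n := by
    rw [PowerSeries.coeff_succ_X_mul, hUcoeff]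
  rw [map_sub, map_sub, h1, h2, h3, sub_zero, map_sum, sum_range_succ] at hcoeff
  have h4 : PowerSeries.coeff (n + 1) (PowerSeries.C (narayana (n + 1)) *
      (PowerSeries.X ^ (n + 1) * (PowerSeries.C X * PowerSeries.X *
        PowerSeries.mk (koshyCoeff (n + 1))))) = 0 := by
    rw [PowerSeries.coeff_C_mul, PowerSeries.coeff_X_pow_mul', if_pos le_rfl, Nat.sub_self,
      mul_assoc, PowerSeries.coeff_C_mul, PowerSeries.coeff_zero_X_mul, mul_zero, mul_zero]
  rw [h4, add_zero, eq_sub_iff_add_eq] at hcoeff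
  rw [← hcoeff, add_comm, mul_sum]
  congr 1
  refine sum_congr rfl fun i hi => ?_
  have hi : i < n := mem_range.mp hi
  rw [PowerSeries.coeff_C_mul, PowerSeries.coeff_X_pow_mul', if_pos (by omega), mul_assoc,
    PowerSeries.coeff_C_mul, show n + 1 - (i + 1) = (n - 1 - i) + 1 by omega,
    PowerSeries.coeff_succ_X_mul, PowerSeries.coeff_mk]
  ring

/-- Generalization of Koshy's formula to Narayana polynomials. -/
theorem narayana_koshy (n : ℕ) (hn : 1 ≤ n) :
    narayana n =
      (1 - Polynomial.X) ^ (n - 1) +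
        Polynomial.X * ∑ k ∈ Finset.Icc 1 (n - 1),
          narayana (n - k) *
            ∑ m ∈ Finset.range k,
              (-1 : Polynomial ℚ) ^ m *
                Polynomial.C (((k - 1).choose m * (n - m).choose k : ℚ)) *
                (1 - Polynomial.X) ^ (k - m - 1) := by
  obtain ⟨N, rfl⟩ := Nat.exists_eq_add_of_le' hn
  rw [narayana_succ_eq, Nat.add_sub_cancel]
  congr 2
  refine sum_nbij' (fun i => N - i) (fun k => N - k) ?_ ?_ ?_ ?_ ?_
  · intro i hi
    have := mem_range.mp hi
    exact mem_Icc.mpr ⟨by omega, by omega⟩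
  · intro k hk
    have := mem_Icc.mp hk
    exact mem_range.mpr (by omega)
  · intro i hi
    have := mem_range.mp hi
    omega
  · intro k hk
    have := mem_Icc.mp hk
    omega
  · intro i hi
    have hi : i < N := mem_range.mp hi
    obtain ⟨l, rfl⟩ : ∃ l, N = i + 1 + l := Nat.exists_eq_add_of_le hi
    rw [show i + 1 + l - 1 - i = l by omega, show i + 1 + l - i = l + 1 by omega,
      show i + 1 + l + 1 - (l + 1) = i + 1 by omega, koshyCoeff]
    rfl
end
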